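/- Let F_1,…,F_n : ℝ^d → ℝ be continuously differentiable and G-Lipschitz, let θ ∈ (0,1], 1 ≤ m ≤ n, λ ≥ 0, ν > 0, and set F̃_i(w) = F_i(w) + (λ/2)‖w‖². For S of size m let F_{θ,S}^ν(w) = max_{π∈P_{θ,S}} ( ∑_{i∈S} π_i F̃_i(w) − ν D_S(π) ) and F̄_θ^ν(w) = E_{S∼U_m}[F_{θ,S}^ν(w)]. Then each F_{θ,S}^ν is differentiable and for every w ∈ ℝ^d, E_{S∼U_m} ‖∇F_{θ,S}^ν(w) − ∇F̄_θ^ν(w)‖² ≤ 8G²/(θm). -/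

import Mathlib

open scoped BigOperators

noncomputable section

/-- The maximizer over `x ∈ [0, c]` of `x * t - ν * (x * log (x * m))`. -/
def cappedExp (ν c m t : ℝ) : ℝ := min c (Real.exp (t / ν - 1) / m)

/-- The convex conjugate of `x ↦ ν * (x * log (x * m))` restricted to `[0, c]`. -/
def cappedConj (ν c m t : ℝ) : ℝ :=
  cappedExp ν c m t * t - ν * (cappedExp ν c m t * Real.log (cappedExp ν c m t * m))

section CappedExp

variable {ν c m : ℝ}

lemma cappedExp_pos (hc : 0 < c) (hm : 0 < m) (t : ℝ) : 0 < cappedExp ν c m t :=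
  lt_min hc (by positivity)

lemma cappedExp_le (t : ℝ) : cappedExp ν c m t ≤ c := min_le_left _ _

lemma continuous_cappedExp : Continuous (cappedExp ν c m) := by
  unfold cappedExp; fun_prop

lemma monotone_cappedExp (hν : 0 < ν) (hm : 0 < m) : Monotone (cappedExp ν c m) := by
  intro s t hst
  unfold cappedExp
  gcongr

lemma mul_sub_entropy_le_cappedConj (hν : 0 < ν) (hc : 0 < c) (hm : 0 < m) (t : ℝ) {x : ℝ}
    (hx : 0 ≤ x) (hxc : x ≤ c) :
    x * t - ν * (x * Real.log (x * m)) ≤ cappedConj ν c m t := by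
  unfold cappedConj
  have hp := cappedExp_pos (ν := ν) hc hm t
  set p := cappedExp ν c m t with hpdef
  have tangent : p * Real.log (p * m) + (Real.log (p * m) + 1) * (x - p)
      ≤ x * Real.log (x * m) := by
    rcases hx.eq_or_lt with rfl | hx
    · simp; nlinarith
    · have h := Real.log_le_sub_one_of_pos (div_pos hp hx)
      rw [Real.log_div hp.ne' hx.ne'] at h
      rw [Real.log_mul hp.ne' hm.ne', Real.log_mul hx.ne' hm.ne']
      have h' := mul_le_mul_of_nonneg_left h hx.le
      have : x * (p / x - 1) = p - x := by field_simp
      rw [this] at h'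
      linarith
  have slack : (t - ν * (Real.log (p * m) + 1)) * (x - p) ≤ 0 := by
    rcases le_total c (Real.exp (t / ν - 1) / m) with h | h
    · have hpc : p = c := min_eq_left h
      refine mul_nonpos_of_nonneg_of_nonpos ?_ (by linarith)
      rw [hpc]
      have h1 : Real.log (c * m) ≤ t / ν - 1 := by
        rw [Real.log_le_iff_le_exp (by positivity)]
        exact (le_div_iff₀ hm).1 h
      have h2 : ν * (Real.log (c * m) + 1) ≤ ν * (t / ν) := by gcongr; linarith
      rw [mul_div_cancel₀ _ hν.ne'] at h2
      linarith
    · have hpe : p = Real.exp (t / ν - 1) / m := min_eq_right h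
      have h0 : t - ν * (Real.log (p * m) + 1) = 0 := by
        rw [hpe, div_mul_cancel₀ _ hm.ne', Real.log_exp]
        field_simp
        ring
      rw [h0, zero_mul]
  have := mul_le_mul_of_nonneg_left tangent hν.le
  linarith

lemma hasDerivAt_cappedConj (hν : 0 < ν) (hc : 0 < c) (hm : 0 < m) (t : ℝ) :
    HasDerivAt (cappedConj ν c m) (cappedExp ν c m t) t := by
  have key : ∀ s u, cappedExp ν c m s * (u - s) ≤ cappedConj ν c m u - cappedConj ν c m s := by
    intro s u
    have := mul_sub_entropy_le_cappedConj hν hc hm u (cappedExp_pos (ν := ν) hc hm s).le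
      (cappedExp_le s)
    rw [cappedConj.eq_def ν c m s]
    linarith
  rw [hasDerivAt_iff_isLittleO, Asymptotics.isLittleO_iff]
  intro ε hε
  filter_upwards [Metric.tendsto_nhds.1 (continuous_cappedExp (ν := ν) (c := c) (m := m)).continuousAt
    ε hε] with u hu
  have h1 := key t u
  have h2 := key u t
  rw [Real.dist_eq] at hu
  rw [smul_eq_mul, Real.norm_eq_abs, Real.norm_eq_abs]
  rw [abs_of_nonneg (by linarith)]
  calc _ ≤ (cappedExp ν c m u - cappedExp ν c m t) * (u - t) := by linarith
    _ ≤ |cappedExp ν c m u - cappedExp ν c m t| * |u - t| := by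
      rw [← abs_mul]; exact le_abs_self _
    _ ≤ ε * |u - t| := by gcongr

lemma exists_sum_cappedExp_eq {ι : Type*} (hν : 0 < ν) (hm : 0 < m) (hc : 1 / m ≤ c)
    (S : Finset ι) (a : ι → ℝ) :
    ∃ η, ∑ i ∈ S, cappedExp ν c m (a i - η) = S.card / m := by
  have hcont : Continuous fun η => ∑ i ∈ S, cappedExp ν c m (a i - η) :=
    continuous_finsetSum _ fun i _ => continuous_cappedExp.comp (by fun_prop)
  obtain ⟨K, hK⟩ : ∃ K, ∀ i ∈ S, |a i| ≤ K := by
    obtain ⟨K, hK⟩ := (S.image fun i => |a i|).bddAbove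
    exact ⟨K, fun i hi => hK (by simpa using ⟨i, hi, rfl⟩)⟩
  have hcard : (S.card : ℝ) / m = ∑ i ∈ S, 1 / m := by
    rw [Finset.sum_const, nsmul_eq_mul]; ring
  have hlow : ∑ i ∈ S, cappedExp ν c m (a i - (K - ν)) ≤ S.card / m := by
    rw [hcard]
    refine Finset.sum_le_sum fun i hi => (min_le_right _ _).trans ?_
    gcongr
    rw [Real.exp_le_one_iff, sub_nonpos, div_le_one hν]
    linarith [(abs_le.1 (hK i hi)).2]
  have hhigh : S.card / m ≤ ∑ i ∈ S, cappedExp ν c m (a i - (-K - ν)) := by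
    rw [hcard]
    refine Finset.sum_le_sum fun i hi => le_min hc ?_
    gcongr
    rw [Real.one_le_exp_iff, sub_nonneg, one_le_div hν]
    linarith [(abs_le.1 (hK i hi)).1]
  exact mem_range_of_exists_le_of_exists_ge hcont ⟨_, hlow⟩ ⟨_, hhigh⟩

lemma sum_abs_cappedExp_sub {ι : Type*} (hν : 0 < ν) (hm : 0 < m) (S : Finset ι) (a : ι → ℝ)
    (η η' : ℝ) :
    ∑ i ∈ S, |cappedExp ν c m (a i - η) - cappedExp ν c m (a i - η')|
      = |∑ i ∈ S, cappedExp ν c m (a i - η) - ∑ i ∈ S, cappedExp ν c m (a i - η')| := by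
  rw [← Finset.sum_sub_distrib]
  wlog h : η' ≤ η generalizing η η'
  · have := this η' η (le_of_not_ge h)
    rw [← abs_neg, ← Finset.sum_neg_distrib]
    simpa only [neg_sub, abs_sub_comm] using this
  have hle : ∀ i ∈ S, cappedExp ν c m (a i - η) - cappedExp ν c m (a i - η') ≤ 0 := fun i _ =>
    sub_nonpos.2 (monotone_cappedExp hν hm (by linarith))
  rw [abs_of_nonpos (Finset.sum_nonpos hle), ← Finset.sum_neg_distrib]
  exact Finset.sum_congr rfl fun i hi => abs_of_nonpos (hle i hi)

end CappedExp

lemma HasFDerivAt.squeeze {E : Type*} [NormedAddCommGroup E] [NormedSpace ℝ E]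
    {l f u : E → ℝ} {D : E →L[ℝ] ℝ} {x : E} (hl : HasFDerivAt l D x) (hu : HasFDerivAt u D x)
    (hlf : ∀ y, l y ≤ f y) (hfu : ∀ y, f y ≤ u y) (hlu : l x = u x) : HasFDerivAt f D x := by
  have hlx : l x = f x := le_antisymm (hlf x) (hlu ▸ hfu x)
  rw [hasFDerivAt_iff_isLittleO, Asymptotics.isLittleO_iff] at *
  intro ε hε
  filter_upwards [hl hε, hu hε] with y h1 h2
  rw [Real.norm_eq_abs, abs_le] at *
  constructor <;> linarith [hlf y, hfu y]

section Sampling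

variable {ι E : Type*} [Fintype ι] [DecidableEq ι] [NormedAddCommGroup E] [InnerProductSpace ℝ E]

lemma card_filter_mem_mul_card (m : ℕ) (hm : 0 < m) (i : ι) :
    (Finset.card {S ∈ Finset.powersetCard m (Finset.univ : Finset ι) | i ∈ S}) * Fintype.card ι
      = (Fintype.card ι).choose m * m := by
  have hn : 0 < Fintype.card ι := Fintype.card_pos_iff.2 ⟨i⟩
  have h := Finset.card_filter_powersetCard_subset {i} (Finset.univ : Finset ι) m (by simp)
    (by simpa using Nat.one_le_iff_ne_zero.2 hm.ne')
  simp only [Finset.singleton_subset_iff, Finset.card_singleton, Finset.card_univ] at h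
  rw [h]
  have := Nat.add_one_mul_choose_eq (Fintype.card ι - 1) (m - 1)
  rw [Nat.sub_add_cancel hn, Nat.sub_add_cancel hm] at this
  rw [mul_comm, this]

lemma exists_card_filter_mem_and_mem (m : ℕ) :
    ∃ β : ℕ, ∀ i j : ι, i ≠ j →
      Finset.card {S ∈ Finset.powersetCard m (Finset.univ : Finset ι) | i ∈ S ∧ j ∈ S} = β := by
  rcases lt_or_ge m 2 with hm | hm
  · refine ⟨0, fun i j hij => ?_⟩
    rw [Finset.card_eq_zero, Finset.filter_eq_empty_iff]
    rintro S hS ⟨hi, hj⟩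
    have : 1 < S.card := Finset.one_lt_card.2 ⟨i, hi, j, hj, hij⟩
    have := (Finset.mem_powersetCard.1 hS).2
    omega
  · refine ⟨(Fintype.card ι - 2).choose (m - 2), fun i j hij => ?_⟩
    have h := Finset.card_filter_powersetCard_subset {i, j} (Finset.univ : Finset ι) m (by simp)
      (by rwa [Finset.card_pair hij])
    simpa only [Finset.insert_subset_iff, Finset.singleton_subset_iff, Finset.card_pair hij,
      Finset.card_univ] using h

lemma sum_powersetCard_norm_sq_le (m : ℕ) (y : ι → E) (hy : ∑ i, y i = 0) (α : ℝ)
    (hα : ∀ i : ι,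
      (Finset.card {S ∈ Finset.powersetCard m (Finset.univ : Finset ι) | i ∈ S} : ℝ) = α) :
    ∑ S ∈ Finset.powersetCard m (Finset.univ : Finset ι), ‖∑ i ∈ S, y i‖ ^ 2
      ≤ α * ∑ i, ‖y i‖ ^ 2 := by
  obtain ⟨β, hβ⟩ := exists_card_filter_mem_and_mem (ι := ι) m
  have expand : ∀ S : Finset ι, ‖∑ i ∈ S, y i‖ ^ 2
      = ∑ i, ∑ j, if i ∈ S ∧ j ∈ S then inner ℝ (y i) (y j) else 0 := by
    intro S
    rw [← real_inner_self_eq_norm_sq, sum_inner]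
    simp_rw [inner_sum, ite_and]
    simp [Finset.sum_ite_mem, Finset.sum_ite_irrel]
  have count : ∀ i j : ι, ∑ S ∈ Finset.powersetCard m (Finset.univ : Finset ι),
      (if i ∈ S ∧ j ∈ S then inner ℝ (y i) (y j) else 0)
      = β * inner ℝ (y i) (y j) + if i = j then (α - β) * ‖y i‖ ^ 2 else 0 := by
    intro i j
    rw [← Finset.sum_filter, Finset.sum_const, nsmul_eq_mul]
    split_ifs with h
    · subst h
      simp only [and_self, hα, real_inner_self_eq_norm_sq]
      ring
    · rw [hβ i j h, add_zero]
  simp_rw [expand]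
  rw [Finset.sum_comm]
  simp_rw [Finset.sum_comm (s := Finset.powersetCard m (Finset.univ : Finset ι)), count,
    Finset.sum_add_distrib, ← Finset.mul_sum, ← inner_sum, hy]
  simp only [inner_zero_right, Finset.sum_const_zero, mul_zero, zero_add, Finset.sum_ite_eq,
    Finset.mem_univ, if_true]
  rw [← Finset.mul_sum]
  gcongr
  linarith [(Nat.cast_nonneg β : (0 : ℝ) ≤ β)]

/-- A sum over a uniformly random subset of size `m` has variance at most that of the sum of
`m` independent uniform samples. -/
lemma sum_powersetCard_norm_sub_sq_le (m : ℕ) (hm : 0 < m) (x : ι → E) :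
    ∑ S ∈ Finset.powersetCard m (Finset.univ : Finset ι),
        ‖∑ i ∈ S, x i - ((m : ℝ) / Fintype.card ι) • ∑ i, x i‖ ^ 2
      ≤ (Fintype.card ι).choose m * (m / Fintype.card ι) * ∑ i, ‖x i‖ ^ 2 := by
  rcases isEmpty_or_nonempty ι with hι | hι
  · simp [Finset.powersetCard_eq_empty.2 (show (∅ : Finset ι).card < m by simpa using hm)]
  have hn : (0 : ℝ) < Fintype.card ι := by exact_mod_cast Fintype.card_pos
  set N : ℝ := (Fintype.card ι : ℝ) with hN
  set μ : E := N⁻¹ • ∑ i, x i with hμ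
  have hsum : ∑ i, x i = N • μ := by rw [hμ, smul_inv_smul₀ hn.ne']
  have hy : ∑ i, (x i - μ) = 0 := by
    rw [Finset.sum_sub_distrib, hsum, Finset.sum_const, Finset.card_univ, ← Nat.cast_smul_eq_nsmul ℝ,
      ← hN, sub_self]
  have hα : ∀ i : ι,
      (Finset.card {S ∈ Finset.powersetCard m (Finset.univ : Finset ι) | i ∈ S} : ℝ)
        = (Fintype.card ι).choose m * (m / N) := by
    intro i
    have := card_filter_mem_mul_card m hm i
    rw [← mul_div_assoc, eq_div_iff hn.ne', hN]
    exact_mod_cast this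
  have hcenter : ∑ i, ‖x i - μ‖ ^ 2 ≤ ∑ i, ‖x i‖ ^ 2 := by
    have h1 : ∀ i, ‖x i - μ‖ ^ 2 = ‖x i‖ ^ 2 - 2 * inner ℝ (x i) μ + ‖μ‖ ^ 2 := fun i =>
      norm_sub_sq_real _ _
    simp_rw [h1, Finset.sum_add_distrib, Finset.sum_sub_distrib, ← Finset.mul_sum, ← sum_inner,
      hsum, real_inner_smul_left, real_inner_self_eq_norm_sq, Finset.sum_const, Finset.card_univ,
      nsmul_eq_mul, ← hN]
    nlinarith [mul_nonneg hn.le (sq_nonneg ‖μ‖)]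
  calc _ = ∑ S ∈ Finset.powersetCard m (Finset.univ : Finset ι), ‖∑ i ∈ S, (x i - μ)‖ ^ 2 := by
        refine Finset.sum_congr rfl fun S hS => ?_
        rw [Finset.sum_sub_distrib, Finset.sum_const, (Finset.mem_powersetCard.1 hS).2, hsum,
          smul_smul, div_mul_cancel₀ _ hn.ne', Nat.cast_smul_eq_nsmul]
    _ ≤ (Fintype.card ι).choose m * (m / N) * ∑ i, ‖x i - μ‖ ^ 2 :=
        sum_powersetCard_norm_sq_le m _ hy _ hα
    _ ≤ _ := by gcongr

end Sampling

lemma sum_norm_sub_mean_sq_le {ι E : Type*} [NormedAddCommGroup E] [InnerProductSpace ℝ E]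
    (A : Finset ι) (x : ι → E) (c : E) :
    ∑ i ∈ A, ‖x i - (A.card : ℝ)⁻¹ • ∑ j ∈ A, x j‖ ^ 2 ≤ ∑ i ∈ A, ‖x i - c‖ ^ 2 := by
  rcases A.eq_empty_or_nonempty with rfl | hA
  · simp
  have hN : (0 : ℝ) < A.card := by exact_mod_cast hA.card_pos
  set N : ℝ := (A.card : ℝ) with hNdef
  set μ : E := N⁻¹ • ∑ j ∈ A, x j with hμ
  have hsum : ∑ i ∈ A, (x i - μ) = 0 := by
    rw [Finset.sum_sub_distrib, Finset.sum_const, ← Nat.cast_smul_eq_nsmul ℝ, ← hNdef, hμ,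
      smul_inv_smul₀ hN.ne', sub_self]
  have h1 : ∀ i, ‖x i - c‖ ^ 2
      = ‖x i - μ‖ ^ 2 + 2 * inner ℝ (x i - μ) (μ - c) + ‖μ - c‖ ^ 2 := fun i => by
    rw [← norm_add_sq_real, sub_add_sub_cancel]
  simp_rw [h1, Finset.sum_add_distrib, ← Finset.mul_sum, ← sum_inner, hsum, inner_zero_left]
  have : 0 ≤ ∑ i ∈ A, ‖μ - c‖ ^ 2 := by positivity
  linarith

/-- Danskin's formula for the entropy-smoothed maximum over the capped simplex. -/
lemma hasFDerivAt_sSup_capped_simplex {ι E : Type*} [NormedAddCommGroup E] [NormedSpace ℝ E]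
    {ν c m : ℝ} (hν : 0 < ν) (hc : 0 < c) (hm : 0 < m) (S : Finset ι) (f : ι → E → ℝ)
    {f' : ι → E →L[ℝ] ℝ} {v : E} (hf : ∀ i, HasFDerivAt (f i) (f' i) v) {η : ℝ}
    (hη : ∑ i ∈ S, cappedExp ν c m (f i v - η) = 1) :
    HasFDerivAt (fun w => sSup {x : ℝ | ∃ π : ι → ℝ, (∀ i, 0 ≤ π i) ∧
        (∀ i ∉ S, π i = 0) ∧ (∑ i ∈ S, π i = 1) ∧ (∀ i, π i ≤ c) ∧
        x = (∑ i ∈ S, π i * f i w) - ν * ∑ i ∈ S, π i * Real.log (π i * m)})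
      (∑ i ∈ S, cappedExp ν c m (f i v - η) • f' i) v := by
  classical
  set p : ι → ℝ := fun i => cappedExp ν c m (f i v - η) with hp
  have dual : ∀ w, ∀ x ∈ {x : ℝ | ∃ π : ι → ℝ, (∀ i, 0 ≤ π i) ∧
        (∀ i ∉ S, π i = 0) ∧ (∑ i ∈ S, π i = 1) ∧ (∀ i, π i ≤ c) ∧
        x = (∑ i ∈ S, π i * f i w) - ν * ∑ i ∈ S, π i * Real.log (π i * m)},
      x ≤ η + ∑ i ∈ S, cappedConj ν c m (f i w - η) := by
    rintro w x ⟨π, h0, -, h1, hle, rfl⟩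
    have h := Finset.sum_le_sum fun i (_ : i ∈ S) =>
      mul_sub_entropy_le_cappedConj hν hc hm (f i w - η) (h0 i) (hle i)
    simp_rw [mul_sub, Finset.sum_sub_distrib, ← Finset.sum_mul, h1, ← Finset.mul_sum] at h
    linarith
  have primal : ∀ w, (∑ i ∈ S, p i * f i w) - ν * ∑ i ∈ S, p i * Real.log (p i * m) ∈
      {x : ℝ | ∃ π : ι → ℝ, (∀ i, 0 ≤ π i) ∧
        (∀ i ∉ S, π i = 0) ∧ (∑ i ∈ S, π i = 1) ∧ (∀ i, π i ≤ c) ∧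
        x = (∑ i ∈ S, π i * f i w) - ν * ∑ i ∈ S, π i * Real.log (π i * m)} := by
    intro w
    have hpos : ∀ i, 0 < p i := fun i => cappedExp_pos hc hm _
    refine ⟨fun i => if i ∈ S then p i else 0, fun i => ?_, fun i hi => if_neg hi, ?_,
      fun i => ?_, ?_⟩
    · dsimp only
      split_ifs
      exacts [(hpos i).le, le_rfl]
    · rw [← hη]
      exact Finset.sum_congr rfl fun i hi => if_pos hi
    · dsimp only
      split_ifs
      exacts [cappedExp_le _, hc.le]
    · congr 1
      · exact Finset.sum_congr rfl fun i hi => by simp only [if_pos hi]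
      · congr 1
        exact Finset.sum_congr rfl fun i hi => by simp only [if_pos hi]
  refine HasFDerivAt.squeeze
    (l := fun w => (∑ i ∈ S, p i * f i w) - ν * ∑ i ∈ S, p i * Real.log (p i * m))
    (u := fun w => η + ∑ i ∈ S, cappedConj ν c m (f i w - η)) ?_ ?_
    (fun w => le_csSup ⟨_, dual w⟩ (primal w)) (fun w => csSup_le ⟨_, primal w⟩ (dual w)) ?_
  · exact (HasFDerivAt.fun_sum fun i _ => (hf i).const_mul (p i)).sub_const _
  · exact (HasFDerivAt.fun_sum fun i _ => (hasDerivAt_cappedConj hν hc hm _).comp_hasFDerivAt v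
      ((hf i).sub_const η)).const_add _
  · simp only [cappedConj, Finset.sum_sub_distrib, ← Finset.mul_sum, mul_sub, ← Finset.sum_mul]
    change _ = η + (_ - (∑ i ∈ S, p i) * η - _)
    rw [hη]
    ring

lemma norm_gradient_le_of_lipschitz {E : Type*} [NormedAddCommGroup E] [InnerProductSpace ℝ E]
    [CompleteSpace E] {f : E → ℝ} {G : ℝ} (hG : 0 ≤ G)
    (hf : ∀ v v', |f v - f v'| ≤ G * ‖v - v'‖) (v : E) : ‖gradient f v‖ ≤ G := by
  rw [gradient, LinearIsometryEquiv.norm_map]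
  exact norm_fderiv_le_of_lip' ℝ hG (Filter.Eventually.of_forall fun w => hf w v)

/-- If each weight vector on `S` is a capped exponential normalized to have sum one, the weighted
average of vectors of norm at most `G` concentrates around a deterministic vector. -/
lemma exists_sum_norm_cappedExp_sub_sq_le {ι E : Type*} [Fintype ι] [DecidableEq ι] [Nonempty ι]
    [NormedAddCommGroup E] [InnerProductSpace ℝ E] {ν c G : ℝ} {m : ℕ} (hν : 0 < ν) (hm : 0 < m)
    (hc : 1 / (m : ℝ) ≤ c) (a : ι → ℝ) (g : ι → E) (hg : ∀ i, ‖g i‖ ≤ G)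
    (η : Finset ι → ℝ)
    (hη : ∀ S : Finset ι, S.card = m → ∑ i ∈ S, cappedExp ν c m (a i - η S) = 1) :
    ∃ z : E, ∑ S ∈ Finset.powersetCard m (Finset.univ : Finset ι),
        ‖∑ i ∈ S, cappedExp ν c m (a i - η S) • g i - z‖ ^ 2
      ≤ (Fintype.card ι).choose m * (4 * G ^ 2 * c) := by
  have hm' : (0 : ℝ) < m := by exact_mod_cast hm
  have hc0 : 0 < c := lt_of_lt_of_le (by positivity) hc
  have hn : (0 : ℝ) < Fintype.card ι := by exact_mod_cast Fintype.card_pos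
  obtain ⟨η₀, hη₀⟩ := exists_sum_cappedExp_eq hν hm' hc Finset.univ a
  set p : ι → ℝ := fun i => cappedExp ν c m (a i - η₀) with hp
  change ∑ i, p i = _ at hη₀
  rw [Finset.card_univ] at hη₀
  have hp0 : ∀ i, 0 < p i := fun i => cappedExp_pos hc0 hm' _
  have hG : 0 ≤ G := (norm_nonneg _).trans (hg (Classical.arbitrary ι))
  have hsq : (m : ℝ) / Fintype.card ι * ∑ i, p i ^ 2 ≤ c := by
    have : ∑ i, p i ^ 2 ≤ c * ∑ i, p i := by
      rw [Finset.mul_sum]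
      refine Finset.sum_le_sum fun i _ => ?_
      rw [sq]
      exact mul_le_mul_of_nonneg_right (cappedExp_le _) (hp0 i).le
    calc _ ≤ (m : ℝ) / Fintype.card ι * (c * ∑ i, p i) := by gcongr
      _ = c := by rw [hη₀]; field_simp
  refine ⟨((m : ℝ) / Fintype.card ι) • ∑ i, p i • g i, ?_⟩
  have hvec := sum_powersetCard_norm_sub_sq_le m hm fun i => p i • g i
  have hmass := sum_powersetCard_norm_sub_sq_le m hm p
  have hmean : ((m : ℝ) / Fintype.card ι) • ∑ i, p i = 1 := by
    rw [hη₀, smul_eq_mul]; field_simp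
  rw [hmean] at hmass
  have hnorm : ∑ i, ‖p i • g i‖ ^ 2 ≤ G ^ 2 * ∑ i, p i ^ 2 := by
    rw [Finset.mul_sum]
    refine Finset.sum_le_sum fun i _ => ?_
    rw [norm_smul, mul_pow, Real.norm_eq_abs, sq_abs, mul_comm]
    gcongr
    exact hg i
  simp only [Real.norm_eq_abs, sq_abs] at hmass
  set N : ℝ := ((Fintype.card ι).choose m : ℝ)
  have hN : 0 ≤ N := Nat.cast_nonneg _
  have pointwise : ∀ S ∈ Finset.powersetCard m (Finset.univ : Finset ι),
      ‖∑ i ∈ S, cappedExp ν c m (a i - η S) • g i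
          - ((m : ℝ) / Fintype.card ι) • ∑ i, p i • g i‖ ^ 2
        ≤ 2 * (G ^ 2 * (∑ i ∈ S, p i - 1) ^ 2)
          + 2 * ‖∑ i ∈ S, p i • g i - ((m : ℝ) / Fintype.card ι) • ∑ i, p i • g i‖ ^ 2 := by
    intro S hS
    have hbias : ‖∑ i ∈ S, cappedExp ν c m (a i - η S) • g i - ∑ i ∈ S, p i • g i‖
        ≤ G * |∑ i ∈ S, p i - 1| := by
      rw [abs_sub_comm, ← hη S (Finset.mem_powersetCard.1 hS).2,
        ← sum_abs_cappedExp_sub hν hm', ← Finset.sum_sub_distrib, Finset.mul_sum]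
      refine norm_sum_le_of_le _ fun i _ => ?_
      rw [← sub_smul, norm_smul, Real.norm_eq_abs, mul_comm]
      gcongr
      exact hg i
    have hsplit := norm_add_le (∑ i ∈ S, cappedExp ν c m (a i - η S) • g i - ∑ i ∈ S, p i • g i)
      (∑ i ∈ S, p i • g i - ((m : ℝ) / Fintype.card ι) • ∑ i, p i • g i)
    rw [sub_add_sub_cancel] at hsplit
    rw [← sq_abs (∑ i ∈ S, p i - 1), ← mul_pow, ← mul_add]
    refine (pow_le_pow_left₀ (norm_nonneg _) hsplit 2).trans (add_sq_le.trans ?_)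
    gcongr
  refine (Finset.sum_le_sum pointwise).trans ?_
  rw [Finset.sum_add_distrib, ← Finset.mul_sum, ← Finset.mul_sum, ← Finset.mul_sum]
  have h1 : G ^ 2 * ∑ S ∈ Finset.powersetCard m (Finset.univ : Finset ι), (∑ i ∈ S, p i - 1) ^ 2
      ≤ G ^ 2 * (N * c) := by
    gcongr
    refine hmass.trans ?_
    rw [mul_assoc]
    gcongr
  have h2 : N * (m / Fintype.card ι) * ∑ i, ‖p i • g i‖ ^ 2 ≤ N * (G ^ 2 * c) := by
    rw [mul_assoc]
    refine mul_le_mul_of_nonneg_left ?_ hN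
    calc _ ≤ (m : ℝ) / Fintype.card ι * (G ^ 2 * ∑ i, p i ^ 2) := by gcongr
      _ = G ^ 2 * ((m : ℝ) / Fintype.card ι * ∑ i, p i ^ 2) := by ring
      _ ≤ G ^ 2 * c := by gcongr
  linarith [hvec.trans h2]

/-- Variance bound for the gradient of the smoothed minibatch superquantile: each
`F_{θ,S}^ν` (for `|S| = m`) is differentiable, and
`E_{S ∼ U_m} ‖∇F_{θ,S}^ν(w) − ∇F̄_θ^ν(w)‖² ≤ 8G²/(θm)`, the expectation being the
average over all subsets `S` of size `m`. -/
theorem variance_of_minibatch_smoothed_superquantile_gradient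
    (d n m : ℕ) (hn : 0 < n) (hm : 0 < m) (hmn : m ≤ n)
    (θ lam ν G : ℝ) (hθ : θ ∈ Set.Ioc (0:ℝ) 1) (hlam : 0 ≤ lam) (hν : 0 < ν) (hG : 0 ≤ G)
    (F : Fin n → EuclideanSpace ℝ (Fin d) → ℝ)
    (hFc1 : ∀ i, ContDiff ℝ 1 (F i))
    (hFlip : ∀ i v v', |F i v - F i v'| ≤ G * ‖v - v'‖) :
    ∀ Fpart : Finset (Fin n) → EuclideanSpace ℝ (Fin d) → ℝ,
      Fpart = (fun S v => sSup {x : ℝ | ∃ π : Fin n → ℝ, (∀ i, 0 ≤ π i) ∧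
        (∀ i ∉ S, π i = 0) ∧ (∑ i ∈ S, π i = 1) ∧ (∀ i, π i ≤ 1 / (θ * m)) ∧
        x = (∑ i ∈ S, π i * (F i v + lam / 2 * ‖v‖ ^ 2))
          - ν * ∑ i ∈ S, π i * Real.log (π i * m)}) →
    ∀ Fbar : EuclideanSpace ℝ (Fin d) → ℝ,
      Fbar = (fun v =>
        (∑ S ∈ Finset.univ.filter (fun S : Finset (Fin n) => S.card = m), Fpart S v)
          / (n.choose m : ℝ)) →
    (∀ S : Finset (Fin n), S.card = m → Differentiable ℝ (Fpart S)) ∧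
    (∀ v, (∑ S ∈ Finset.univ.filter (fun S : Finset (Fin n) => S.card = m),
          ‖gradient (Fpart S) v - gradient Fbar v‖ ^ 2) / (n.choose m : ℝ)
        ≤ 8 * G ^ 2 / (θ * m)) := by
  rintro Fpart rfl Fbar rfl
  have hm' : (0 : ℝ) < m := by exact_mod_cast hm
  have hc : 1 / (m : ℝ) ≤ 1 / (θ * m) :=
    one_div_le_one_div_of_le (mul_pos hθ.1 hm') (mul_le_of_le_one_left hm'.le hθ.2)
  have hc0 : 0 < 1 / (θ * m) := lt_of_lt_of_le (by positivity) hc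
  have : Nonempty (Fin n) := ⟨⟨0, hn⟩⟩
  let r : EuclideanSpace ℝ (Fin d) → ℝ := fun v => lam / 2 * ‖v‖ ^ 2
  have hr : Differentiable ℝ r := (differentiable_id.norm_sq ℝ).const_mul _
  have hF : ∀ i, Differentiable ℝ (F i) := fun i => (hFc1 i).differentiable one_ne_zero
  have hthreshold : ∀ (S : Finset (Fin n)) v, ∃ η : ℝ, S.card = m →
      ∑ i ∈ S, cappedExp ν (1 / (θ * m)) m (F i v + r v - η) = 1 := by
    intro S v
    obtain ⟨η, hη⟩ := exists_sum_cappedExp_eq hν hm' hc S fun i => F i v + r v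
    exact ⟨η, fun hS => by rw [hη, hS, div_self hm'.ne']⟩
  choose η hη using hthreshold
  have hderiv := fun (S : Finset (Fin n)) (hS : S.card = m) v =>
    hasFDerivAt_sSup_capped_simplex hν hc0 hm' S (fun i w => F i w + r w)
      (fun i => (hF i v).hasFDerivAt.add (hr v).hasFDerivAt) (hη S v hS)
  refine ⟨fun S hS v => (hderiv S hS v).differentiableAt, fun v => ?_⟩
  set Fpart : Finset (Fin n) → EuclideanSpace ℝ (Fin d) → ℝ := fun S v =>
    sSup {x : ℝ | ∃ π : Fin n → ℝ, (∀ i, 0 ≤ π i) ∧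
        (∀ i ∉ S, π i = 0) ∧ (∑ i ∈ S, π i = 1) ∧ (∀ i, π i ≤ 1 / (θ * m)) ∧
        x = (∑ i ∈ S, π i * (F i v + lam / 2 * ‖v‖ ^ 2))
          - ν * ∑ i ∈ S, π i * Real.log (π i * m)} with hFpart
  have hfilter : Finset.univ.filter (fun S : Finset (Fin n) => S.card = m)
      = Finset.powersetCard m Finset.univ := by
    ext S
    simp
  simp only [hfilter]
  have hcard : (n.choose m : ℝ) = (Finset.powersetCard m (Finset.univ : Finset (Fin n))).card := by
    simp
  have hpos : (0 : ℝ) < n.choose m := by exact_mod_cast Nat.choose_pos hmn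
  have hgrad : ∀ S ∈ Finset.powersetCard m (Finset.univ : Finset (Fin n)),
      gradient (Fpart S) v
        = ∑ i ∈ S, cappedExp ν (1 / (θ * m)) m (F i v + r v - η S v) • gradient (F i) v
          + gradient r v := by
    intro S hS
    have hS' := (Finset.mem_powersetCard.1 hS).2
    have h := (hderiv S hS' v).fderiv
    rw [gradient, hFpart]
    dsimp only
    rw [h]
    simp only [map_sum, map_smul, map_add, smul_add, Finset.sum_add_distrib, ← Finset.sum_smul,
      hη S v hS', one_smul]
    rfl
  have hmean : gradient (fun v => (∑ S ∈ Finset.powersetCard m Finset.univ, Fpart S v)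
        / (n.choose m : ℝ)) v
      = ((Finset.powersetCard m (Finset.univ : Finset (Fin n))).card : ℝ)⁻¹ •
        ∑ S ∈ Finset.powersetCard m Finset.univ, gradient (Fpart S) v := by
    have h := (HasFDerivAt.fun_sum fun S (hS : S ∈ Finset.powersetCard m Finset.univ) =>
      (hderiv S (Finset.mem_powersetCard.1 hS).2 v).differentiableAt.hasFDerivAt).mul_const
        ((n.choose m : ℝ)⁻¹)
    simp only [div_eq_mul_inv, ← hcard]
    rw [gradient, HasFDerivAt.fderiv h, map_smul, map_sum]
    rfl
  obtain ⟨z, hz⟩ := exists_sum_norm_cappedExp_sub_sq_le hν hm hc (fun i => F i v + r v)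
    (fun i => gradient (F i) v) (fun i => norm_gradient_le_of_lipschitz hG (hFlip i) v)
    (fun S => η S v) (fun S => hη S v)
  rw [Fintype.card_fin] at hz
  rw [hmean, div_le_iff₀ hpos]
  refine (sum_norm_sub_mean_sq_le _ _ (z + gradient r v)).trans ?_
  calc _ = ∑ S ∈ Finset.powersetCard m (Finset.univ : Finset (Fin n)),
        ‖∑ i ∈ S, cappedExp ν (1 / (θ * m)) m (F i v + r v - η S v) • gradient (F i) v - z‖ ^ 2 :=
        Finset.sum_congr rfl fun S hS => by rw [hgrad S hS, add_sub_add_right_eq_sub]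
    _ ≤ n.choose m * (4 * G ^ 2 * (1 / (θ * m))) := hz
    _ ≤ n.choose m * (8 * G ^ 2 * (1 / (θ * m))) := by gcongr; norm_num
    _ = 8 * G ^ 2 / (θ * m) * n.choose m := by ring
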